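/- (Equivalence of the symmetric CMC and local uncertainty relations) Let ρ be a density matrix on ℂ^{d_A} ⊗ ℂ^{d_B}, let (A_i)_{i=1,…,d_A²} and (B_j)_{j=1,…,d_B²} be Hilbert–Schmidt orthonormal families of Hermitian matrices on the two factors, and let γ^S be the symmetric block covariance matrix of ρ with respect to the observables {A_i ⊗ 1} ∪ {1 ⊗ B_j}. Then the following are equivalent: (1) there exist finitely many weights p_k ≥ 0 with Σ_k p_k = 1 and unit vectors a_k ∈ ℂ^{d_A}, b_k ∈ ℂ^{d_B} such that γ^S − (Σ_k p_k γ^S(a_k a_kᴴ,{A_i})) ⊕ (Σ_k p_k γ^S(b_k b_kᴴ,{B_j})) is positive semidefinite; (2) for every finite family of Hermitian matrices (Â_k) on ℂ^{d_A} and (B̂_k) on ℂ^{d_B}, one has Σ_k δ²_ρ(Â_k ⊗ 1 + 1 ⊗ B̂_k) ≥ inf{ Σ_k δ²_{a aᴴ}(Â_k) : a ∈ ℂ^{d_A}, ‖a‖ = 1 } + inf{ Σ_k δ²_{b bᴴ}(B̂_k) : b ∈ ℂ^{d_B}, ‖b‖ = 1 }, i.e., ρ satisfies every local uncertainty relation.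 -/

import Mathlib

open Matrix BigOperators
open scoped ComplexOrder Kronecker

noncomputable section

/-- Expectation value ⟨X⟩ = tr(ρ X). -/
def expVal {n : Type*} [Fintype n] (ρ X : Matrix n n ℂ) : ℂ := (ρ * X).trace

/-- The symmetric covariance matrix of a family of observables. -/
def symCovMat {n ι : Type*} [Fintype n] [Fintype ι]
    (ρ : Matrix n n ℂ) (M : ι → Matrix n n ℂ) : Matrix ι ι ℂ :=
  Matrix.of fun i j =>
    (expVal ρ (M i * M j) + expVal ρ (M j * M i)) / 2 - expVal ρ (M i) * expVal ρ (M j)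

/-- The variance δ²_σ(X) = tr(σ X²) − (tr(σ X))², as a real number. -/
def realVar {n : Type*} [Fintype n] (σ X : Matrix n n ℂ) : ℝ :=
  ((σ * (X * X)).trace).re - (((σ * X).trace).re) ^ 2

theorem IsCompact.convexHull_of_finiteDimensional {E : Type*} [AddCommGroup E] [Module ℝ E]
    [TopologicalSpace E] [IsTopologicalAddGroup E] [ContinuousSMul ℝ E] [FiniteDimensional ℝ E]
    {s : Set E} (hs : IsCompact s) : IsCompact (convexHull ℝ s) := by
  classical
  rcases s.eq_empty_or_nonempty with rfl | ⟨x₀, hx₀⟩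
  · simp
  set N := Module.finrank ℝ E + 1
  have hK : IsCompact (stdSimplex ℝ (Fin N) ×ˢ Set.univ.pi fun _ : Fin N => s) :=
    (isCompact_stdSimplex ℝ (Fin N)).prod (isCompact_univ_pi fun _ => hs)
  have hf : Continuous fun q : (Fin N → ℝ) × (Fin N → E) => ∑ i, q.1 i • q.2 i := by fun_prop
  convert hK.image hf using 1
  ext x
  constructor
  · intro hx
    obtain ⟨ι, _, z, w, hz, haff, hw, hw1, rfl⟩ := eq_pos_convex_span_of_mem_convexHull hx
    have hcard : Fintype.card ι ≤ Fintype.card (Fin N) := by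
      rw [Fintype.card_fin]
      exact haff.card_le_finrank_succ.trans
        (Nat.add_le_add_right (Submodule.finrank_le _) 1)
    obtain ⟨e⟩ := Function.Embedding.nonempty_of_card_le hcard
    have hext : ∀ i, Function.extend e w 0 (e i) = w i := fun i => e.injective.extend_apply _ _ i
    have hsupp : ∀ j, j ∉ Set.range e → Function.extend e w 0 j = 0 := fun j hj => by
      rw [Function.extend_apply' _ _ _ hj]; rfl
    refine ⟨(Function.extend e w 0, Function.extend e z fun _ => x₀), ⟨⟨fun j => ?_, ?_⟩, ?_⟩, ?_⟩
    · by_cases hj : j ∈ Set.range e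
      · obtain ⟨i, rfl⟩ := hj
        simpa [hext] using (hw i).le
      · simp [hsupp j hj]
    · rw [← hw1]
      exact (Fintype.sum_of_injective e e.injective _ _ hsupp fun i => (hext i).symm).symm
    · intro j _
      by_cases hj : j ∈ Set.range e
      · obtain ⟨i, rfl⟩ := hj
        simpa [e.injective.extend_apply] using hz ⟨i, rfl⟩
      · simpa [Function.extend_apply' _ _ _ hj] using hx₀
    · refine (Fintype.sum_of_injective e e.injective _ _ (fun j hj => ?_) fun i => ?_).symm
      · simp [hsupp j hj]
      · simp [e.injective.extend_apply]
  · rintro ⟨⟨w, z⟩, ⟨⟨hw0, hw1⟩, hz⟩, rfl⟩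
    exact mem_convexHull_of_exists_fintype w z hw0 hw1 (fun i => hz i trivial) rfl

/-- The quadratic form `∑ i j, v i * v j * X i j` of a real square array. -/
def quadSum {ι : Type*} [Fintype ι] (X : ι → ι → ℝ) (v : ι → ℝ) : ℝ :=
  ∑ i, ∑ j, v i * v j * X i j

theorem quadSum_add {ι : Type*} [Fintype ι] (X Y : ι → ι → ℝ) (v : ι → ℝ) :
    quadSum (X + Y) v = quadSum X v + quadSum Y v := by
  simp [quadSum, mul_add, Finset.sum_add_distrib]

theorem quadSum_smul {ι : Type*} [Fintype ι] (c : ℝ) (X : ι → ι → ℝ) (v : ι → ℝ) :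
    quadSum (c • X) v = c * quadSum X v := by
  simp only [quadSum, Finset.mul_sum, Pi.smul_apply, smul_eq_mul]
  exact Finset.sum_congr rfl fun i _ => Finset.sum_congr rfl fun j _ => by ring

theorem quadSum_sum {ι κ : Type*} [Fintype ι] [Fintype κ] (p : κ → ℝ) (X : κ → ι → ι → ℝ)
    (v : ι → ℝ) : quadSum (∑ k, p k • X k) v = ∑ k, p k * quadSum (X k) v := by
  let L : (ι → ι → ℝ) →ₗ[ℝ] ℝ :=
    { toFun := fun Y => quadSum Y v
      map_add' := fun Y Z => quadSum_add Y Z v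
      map_smul' := fun c Y => quadSum_smul c Y v }
  exact (map_sum L (fun k => p k • X k) Finset.univ).trans
    (Finset.sum_congr rfl fun k _ => quadSum_smul _ _ _)

theorem continuous_quadSum {ι : Type*} [Fintype ι] (v : ι → ℝ) :
    Continuous fun X : ι → ι → ℝ => quadSum X v := by
  unfold quadSum
  fun_prop

open scoped MatrixOrder in
theorem Matrix.PosSemidef.exists_sum_quadSum {ι : Type*} [Fintype ι] {W : Matrix ι ι ℝ}
    (hW : W.PosSemidef) :
    ∃ w : ι → ι → ℝ, ∀ X : ι → ι → ℝ, ∑ i, ∑ j, X i j * W i j = ∑ k, quadSum X (w k) := by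
  classical
  obtain ⟨C, rfl⟩ := CStarAlgebra.nonneg_iff_eq_star_mul_self.mp hW.nonneg
  refine ⟨C, fun X => ?_⟩
  simp only [quadSum, Matrix.mul_apply, Matrix.star_apply, star_trivial, Finset.mul_sum]
  rw [Finset.sum_comm_cycle]
  refine Finset.sum_congr rfl fun k _ => ?_
  refine Finset.sum_congr rfl fun i _ => Finset.sum_congr rfl fun j _ => by ring

theorem exists_separating_quadSum {ι : Type*} [Fintype ι]
    {S : Set (ι → ι → ℝ)} (hS : IsCompact S) (hconv : Convex ℝ S) (g : ι → ι → ℝ)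
    (h : ∀ X ∈ S, ∃ v, quadSum g v < quadSum X v) :
    ∃ (w : ι → ι → ℝ) (c : ℝ), ∑ k, quadSum g (w k) < c ∧ ∀ X ∈ S, c < ∑ k, quadSum X (w k) := by
  classical
  set T : Set (ι → ι → ℝ) := {X | ∀ v, quadSum X v ≤ quadSum g v} with hT
  have hTc : IsClosed T := by
    rw [hT, Set.ofPred_forall]
    exact isClosed_iInter fun v => isClosed_le (continuous_quadSum v) continuous_const
  have hTconv : Convex ℝ T := by
    intro X hX Y hY a b ha hb hab v
    rw [quadSum_add, quadSum_smul, quadSum_smul]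
    calc a * quadSum X v + b * quadSum Y v ≤ a * quadSum g v + b * quadSum g v := by
          gcongr
          · exact hX v
          · exact hY v
      _ = quadSum g v := by rw [← add_mul, hab, one_mul]
  have hdisj : Disjoint T S := Set.disjoint_left.2 fun X hXT hXS => by
    obtain ⟨v, hv⟩ := h X hXS
    exact (hXT v).not_gt hv
  obtain ⟨f, u, c, hf, huc, hfS⟩ :=
    geometric_hahn_banach_closed_compact hTconv hTc hconv hS hdisj
  have hnonneg : ∀ P : ι → ι → ℝ, (∀ v, 0 ≤ quadSum P v) → 0 ≤ f P := by
    intro P hP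
    by_contra! hneg
    obtain ⟨n, hn⟩ := exists_nat_gt ((u - f g) / -f P)
    rw [div_lt_iff₀ (by linarith)] at hn
    have hmem : g + (-(n : ℝ)) • P ∈ T := fun v => by
      rw [quadSum_add, quadSum_smul]
      nlinarith [hP v, n.cast_nonneg (α := ℝ)]
    have := hf _ hmem
    simp only [map_add, map_smul, smul_eq_mul] at this
    linarith
  have hzero : ∀ P : ι → ι → ℝ, (∀ v, quadSum P v = 0) → f P = 0 := by
    intro P hP
    refine le_antisymm ?_ (hnonneg P fun v => (hP v).ge)
    have := hnonneg ((-1 : ℝ) • P) fun v => by rw [quadSum_smul, hP v, mul_zero]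
    simpa using this
  let W : Matrix ι ι ℝ := Matrix.of fun i j => f (Pi.single i (Pi.single j 1))
  have hfW : ∀ X : ι → ι → ℝ, f X = ∑ i, ∑ j, X i j * W i j := by
    intro X
    have hX : X = ∑ i, ∑ j, X i j • (Pi.single i (Pi.single j 1) : ι → ι → ℝ) := by
      ext i j
      simp [Finset.sum_apply, Pi.single_apply, ite_apply]
    conv_lhs => rw [hX]
    simp [W]
  have hquad : ∀ i j v, quadSum (Pi.single i (Pi.single j 1) : ι → ι → ℝ) v = v i * v j := by
    intro i j v
    simp [quadSum, Pi.single_apply, ite_apply]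
  have hWH : W.IsHermitian := by
    ext i j
    have := hzero ((Pi.single j (Pi.single i 1) : ι → ι → ℝ)
        + (-1 : ℝ) • (Pi.single i (Pi.single j 1) : ι → ι → ℝ))
      fun v => by rw [quadSum_add, quadSum_smul, hquad, hquad]; ring
    simp only [map_add, map_smul, smul_eq_mul] at this
    simp only [Matrix.conjTranspose_apply, star_trivial, W, Matrix.of_apply]
    linarith
  have hWP : W.PosSemidef := by
    refine .of_dotProduct_mulVec_nonneg hWH fun x => ?_
    have := hnonneg (fun i j => x i * x j) fun v => by
      have : quadSum (fun i j => x i * x j) v = (∑ i, v i * x i) ^ 2 := by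
        rw [sq, Finset.sum_mul_sum]
        exact Finset.sum_congr rfl fun i _ => Finset.sum_congr rfl fun j _ => by ring
      rw [this]; positivity
    rw [hfW] at this
    refine this.trans_eq ?_
    simp only [dotProduct, Matrix.mulVec, Finset.mul_sum, star_trivial]
    exact Finset.sum_congr rfl fun i _ => Finset.sum_congr rfl fun j _ => by ring
  obtain ⟨w, hw⟩ := hWP.exists_sum_quadSum
  refine ⟨w, c, ?_, fun X hX => ?_⟩
  · rw [← hw, ← hfW]
    exact (hf g fun v => le_rfl).trans huc
  · rw [← hw, ← hfW]
    exact hfS X hX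

theorem trace_mul_im_eq_zero {n : Type*} [Fintype n] {σ X : Matrix n n ℂ} (hσ : σ.IsHermitian)
    (hX : X.IsHermitian) : ((σ * X).trace).im = 0 := by
  have h : star (σ * X).trace = (σ * X).trace := by
    rw [← Matrix.trace_conjTranspose, Matrix.conjTranspose_mul, hσ.eq, hX.eq, Matrix.trace_mul_comm]
  exact Complex.conj_eq_iff_im.1 h

theorem star_trace_mul_mul {n : Type*} [Fintype n] {σ X Y : Matrix n n ℂ} (hσ : σ.IsHermitian)
    (hX : X.IsHermitian) (hY : Y.IsHermitian) :
    star (σ * (X * Y)).trace = (σ * (Y * X)).trace := by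
  rw [← Matrix.trace_conjTranspose, Matrix.conjTranspose_mul, Matrix.conjTranspose_mul, hσ.eq,
    hX.eq, hY.eq, Matrix.trace_mul_comm]

theorem symCovMat_comm {n ι : Type*} [Fintype n] [Fintype ι] (σ : Matrix n n ℂ)
    (M : ι → Matrix n n ℂ) (i j : ι) : symCovMat σ M i j = symCovMat σ M j i := by
  simp only [symCovMat, Matrix.of_apply]
  ring

theorem symCovMat_im {n ι : Type*} [Fintype n] [Fintype ι] {σ : Matrix n n ℂ}
    {M : ι → Matrix n n ℂ} (hσ : σ.IsHermitian) (hM : ∀ i, (M i).IsHermitian) (i j : ι) :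
    (symCovMat σ M i j).im = 0 := by
  have h := congrArg Complex.im (star_trace_mul_mul hσ (hM i) (hM j))
  simp only [Complex.star_def, Complex.conj_im] at h
  simp [symCovMat, expVal, trace_mul_im_eq_zero hσ (hM _), ← h]

theorem quadSum_symCovMat {n ι : Type*} [Fintype n] [Fintype ι] {σ : Matrix n n ℂ}
    {M : ι → Matrix n n ℂ} (hσ : σ.IsHermitian) (hM : ∀ i, (M i).IsHermitian) (v : ι → ℝ) :
    quadSum (fun i j => (symCovMat σ M i j).re) v = realVar σ (∑ i, (v i : ℂ) • M i) := by
  have h1 : ((σ * ∑ i, (v i : ℂ) • M i).trace).re = ∑ i, v i * ((σ * M i).trace).re := by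
    simp [Finset.mul_sum, Matrix.trace_sum]
  have h2 : ((σ * ((∑ i, (v i : ℂ) • M i) * ∑ i, (v i : ℂ) • M i)).trace).re
      = ∑ i, ∑ j, v i * v j * ((σ * (M i * M j)).trace).re := by
    simp [Finset.mul_sum, Finset.sum_mul, Matrix.trace_sum, mul_assoc]
    rw [Finset.sum_comm]
    exact Finset.sum_congr rfl fun i _ => Finset.sum_congr rfl fun j _ => by ring
  have h3 : ∑ i, ∑ j, v i * v j * ((σ * (M j * M i)).trace).re
      = ∑ i, ∑ j, v i * v j * ((σ * (M i * M j)).trace).re := by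
    rw [Finset.sum_comm]
    exact Finset.sum_congr rfl fun i _ => Finset.sum_congr rfl fun j _ => by ring
  have h4 : quadSum (fun i j => (symCovMat σ M i j).re) v
      = (∑ i, ∑ j, v i * v j * ((σ * (M i * M j)).trace).re
        + ∑ i, ∑ j, v i * v j * ((σ * (M j * M i)).trace).re) / 2
        - (∑ i, v i * ((σ * M i).trace).re) * ∑ j, v j * ((σ * M j).trace).re := by
    rw [Finset.sum_mul_sum, ← Finset.sum_add_distrib, Finset.sum_div, ← Finset.sum_sub_distrib]
    refine Finset.sum_congr rfl fun i _ => ?_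
    rw [← Finset.sum_add_distrib, Finset.sum_div, ← Finset.sum_sub_distrib]
    refine Finset.sum_congr rfl fun j _ => ?_
    simp [symCovMat, expVal, trace_mul_im_eq_zero hσ (hM _)]
    ring
  rw [h4, h3, realVar, h1, h2]
  ring

theorem re_star_dotProduct_mulVec {ι : Type*} [Fintype ι] {G : Matrix ι ι ℂ}
    (him : ∀ i j, (G i j).im = 0) (x : ι → ℂ) :
    (star x ⬝ᵥ G *ᵥ x).re = quadSum (fun i j => (G i j).re) (fun i => (x i).re)
      + quadSum (fun i j => (G i j).re) (fun i => (x i).im) := by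
  simp only [dotProduct, Matrix.mulVec, Finset.mul_sum, Complex.re_sum, quadSum,
    ← Finset.sum_add_distrib]
  refine Finset.sum_congr rfl fun i _ => Finset.sum_congr rfl fun j _ => ?_
  simp [him]
  ring

theorem posSemidef_iff_quadSum {ι : Type*} [Fintype ι] {G : Matrix ι ι ℂ}
    (him : ∀ i j, (G i j).im = 0) (hsymm : ∀ i j, G i j = G j i) :
    G.PosSemidef ↔ ∀ v, 0 ≤ quadSum (fun i j => (G i j).re) v := by
  constructor
  · intro hG v
    have h := (Complex.nonneg_iff.1 (hG.dotProduct_mulVec_nonneg fun i => (v i : ℂ))).1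
    rw [re_star_dotProduct_mulVec him] at h
    simpa [quadSum] using h
  · intro h
    have hH : G.IsHermitian := by
      ext i j
      rw [Matrix.conjTranspose_apply, hsymm j i]
      exact Complex.conj_eq_iff_im.2 (him i j)
    refine .of_dotProduct_mulVec_nonneg hH fun x => Complex.nonneg_iff.2 ⟨?_, ?_⟩
    · rw [re_star_dotProduct_mulVec him]
      exact add_nonneg (h _) (h _)
    · exact (hH.im_star_dotProduct_mulVec_self x).symm

theorem realVar_nonneg {n : Type*} [Fintype n] {σ X : Matrix n n ℂ} (hσ : σ.PosSemidef)
    (hσ1 : σ.trace = 1) (hX : X.IsHermitian) : 0 ≤ realVar σ X := by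
  classical
  set m : ℝ := ((σ * X).trace).re with hm
  set Y : Matrix n n ℂ := X - (m : ℂ) • 1 with hY
  have hYH : Yᴴ = Y := by simp [hY, hX.eq]
  have h := (Complex.nonneg_iff.1 (hσ.conjTranspose_mul_mul_same Y).trace_nonneg).1
  rw [hYH, Matrix.trace_mul_comm, ← mul_assoc, Matrix.trace_mul_comm] at h
  have h2 : ((σ * (Y * Y)).trace).re = realVar σ X := by
    simp [hY, sub_mul, mul_sub, Matrix.trace_sub, hσ1, realVar, ← hm]
    ring
  rwa [← h2]

theorem isHermitian_vecMulVec_star {n : Type*} [Fintype n] (a : n → ℂ) :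
    (vecMulVec a (star a)).IsHermitian :=
  (posSemidef_vecMulVec_self_star a).isHermitian

theorem isHermitian_sum_ofReal_smul {n ι : Type*} [Fintype ι] {M : ι → Matrix n n ℂ}
    (hM : ∀ i, (M i).IsHermitian) (v : ι → ℝ) : (∑ i, (v i : ℂ) • M i).IsHermitian := by
  simp only [Matrix.IsHermitian, Matrix.conjTranspose_sum, Matrix.conjTranspose_smul,
    Complex.star_def, Complex.conj_ofReal, (hM _).eq]

theorem exists_real_coeff {n ι : Type*} [Fintype n] [Fintype ι] [DecidableEq ι]
    (hcard : Fintype.card ι = Fintype.card n ^ 2) {M : ι → Matrix n n ℂ}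
    (hM : ∀ i, (M i).IsHermitian)
    (hON : ∀ i j, (M i * M j).trace = if i = j then 1 else 0)
    {X : Matrix n n ℂ} (hX : X.IsHermitian) : ∃ v : ι → ℝ, X = ∑ i, (v i : ℂ) • M i := by
  classical
  have hcoef : ∀ (c : ι → ℂ) i, (M i * ∑ j, c j • M j).trace = c i := by
    intro c i
    simp [Finset.mul_sum, Matrix.trace_sum, hON]
  have hli : LinearIndependent ℂ M := by
    rw [Fintype.linearIndependent_iff]
    intro c hc i
    rw [← hcoef c i, hc]
    simp
  have hspan := hli.span_eq_top_of_card_eq_finrank' (by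
    rw [hcard, Module.finrank_matrix]; simp [sq])
  obtain ⟨c, hc⟩ := (Submodule.mem_span_range_iff_exists_fun ℂ).1
    (hspan ▸ Submodule.mem_top : X ∈ Submodule.span ℂ (Set.range M))
  refine ⟨fun i => (c i).re, ?_⟩
  rw [← hc]
  refine Finset.sum_congr rfl fun i _ => ?_
  have him : (c i).im = 0 := by
    rw [← hcoef c i, hc]
    exact trace_mul_im_eq_zero (hM i) hX
  congr 1
  exact Complex.ext rfl (by simpa using him)

theorem isCompact_unit_vectors (n : Type*) [Fintype n] :
    IsCompact {a : n → ℂ | star a ⬝ᵥ a = 1} := by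
  refine Metric.isCompact_of_isClosed_isBounded (isClosed_eq (by fun_prop) continuous_const) ?_
  refine (Metric.isBounded_closedBall (x := (0 : n → ℂ)) (r := 1)).subset fun a ha => ?_
  rw [mem_closedBall_zero_iff, pi_norm_le_iff_of_nonneg zero_le_one]
  intro i
  have h : ∑ j, ‖a j‖ ^ 2 = 1 := by
    have h := congrArg Complex.re (show star a ⬝ᵥ a = 1 from ha)
    simpa [dotProduct, Complex.conj_mul', ← Complex.ofReal_pow] using h
  have := Finset.single_le_sum (f := fun j => ‖a j‖ ^ 2) (fun j _ => by positivity)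
    (Finset.mem_univ i)
  nlinarith [norm_nonneg (a i)]

theorem exists_unit_vector (n : Type*) [Fintype n] [Nonempty n] :
    ∃ a : n → ℂ, star a ⬝ᵥ a = 1 := by
  classical
  obtain ⟨i⟩ := ‹Nonempty n›
  exact ⟨Pi.single i 1, by simp⟩

/-- The real entries of the block-diagonal covariance matrix of a pair of pure states. -/
def blockCov {m n ι κ : Type*} [Fintype m] [Fintype n] [Fintype ι] [Fintype κ]
    (A : ι → Matrix m m ℂ) (B : κ → Matrix n n ℂ) (q : (m → ℂ) × (n → ℂ)) :
    ι ⊕ κ → ι ⊕ κ → ℝ := fun i j =>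
  (fromBlocks (symCovMat (vecMulVec q.1 (star q.1)) A) 0 0
    (symCovMat (vecMulVec q.2 (star q.2)) B) i j).re

theorem continuous_blockCov {m n ι κ : Type*} [Fintype m] [Fintype n] [Fintype ι] [Fintype κ]
    (A : ι → Matrix m m ℂ) (B : κ → Matrix n n ℂ) : Continuous (blockCov A B) := by
  refine continuous_pi fun i => continuous_pi fun j => Complex.continuous_re.comp ?_
  rcases i with i | i <;> rcases j with j | j <;>
    simp only [fromBlocks_apply₁₁, fromBlocks_apply₁₂, fromBlocks_apply₂₁, fromBlocks_apply₂₂,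
      symCovMat, expVal, Matrix.of_apply, Matrix.zero_apply] <;> fun_prop

theorem quadSum_blockCov {m n ι κ : Type*} [Fintype m] [Fintype n] [Fintype ι] [Fintype κ]
    {A : ι → Matrix m m ℂ} {B : κ → Matrix n n ℂ}
    (hA : ∀ i, (A i).IsHermitian) (hB : ∀ j, (B j).IsHermitian)
    (q : (m → ℂ) × (n → ℂ)) (v : ι ⊕ κ → ℝ) :
    quadSum (blockCov A B q) v
      = realVar (vecMulVec q.1 (star q.1)) (∑ i, (v (.inl i) : ℂ) • A i)
        + realVar (vecMulVec q.2 (star q.2)) (∑ j, (v (.inr j) : ℂ) • B j) := by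
  rw [← quadSum_symCovMat (isHermitian_vecMulVec_star q.1) hA fun i => v (.inl i),
    ← quadSum_symCovMat (isHermitian_vecMulVec_star q.2) hB fun j => v (.inr j)]
  simp [quadSum, blockCov]

theorem isHermitian_sumElim_kronecker {m n ι κ : Type*} [DecidableEq m] [DecidableEq n]
    {A : ι → Matrix m m ℂ} {B : κ → Matrix n n ℂ}
    (hA : ∀ i, (A i).IsHermitian) (hB : ∀ j, (B j).IsHermitian) (i : ι ⊕ κ) :
    (Sum.elim (fun i => A i ⊗ₖ (1 : Matrix n n ℂ)) (fun j => (1 : Matrix m m ℂ) ⊗ₖ B j)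
      i).IsHermitian := by
  rcases i with i | i <;>
    simp [Matrix.IsHermitian, conjTranspose_kronecker, (hA _).eq, (hB _).eq]

theorem sum_smul_sumElim_kronecker {m n ι κ : Type*} [DecidableEq m] [DecidableEq n]
    [Fintype ι] [Fintype κ]
    {A : ι → Matrix m m ℂ} {B : κ → Matrix n n ℂ}
    (v : ι ⊕ κ → ℝ) :
    ∑ i, (v i : ℂ) • Sum.elim (fun i => A i ⊗ₖ (1 : Matrix n n ℂ))
        (fun j => (1 : Matrix m m ℂ) ⊗ₖ B j) i
      = (∑ i, (v (.inl i) : ℂ) • A i) ⊗ₖ (1 : Matrix n n ℂ)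
        + (1 : Matrix m m ℂ) ⊗ₖ ∑ j, (v (.inr j) : ℂ) • B j := by
  ext ⟨i, i'⟩ ⟨j, j'⟩
  simp [Matrix.sum_apply, kroneckerMap_apply, Finset.sum_mul, Finset.mul_sum, mul_assoc,
    mul_left_comm]

theorem posSemidef_sub_fromBlocks_iff {m n ι κ : Type*} [Fintype m] [Fintype n]
    [DecidableEq m] [DecidableEq n] [Fintype ι] [Fintype κ]
    {A : ι → Matrix m m ℂ} {B : κ → Matrix n n ℂ}
    {ρ : Matrix (m × n) (m × n) ℂ} (hρ : ρ.IsHermitian)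
    (hA : ∀ i, (A i).IsHermitian) (hB : ∀ j, (B j).IsHermitian)
    {τ : Type*} [Fintype τ] (p : τ → ℝ) (a : τ → m → ℂ) (b : τ → n → ℂ) :
    (symCovMat ρ (Sum.elim (fun i => A i ⊗ₖ (1 : Matrix n n ℂ))
          (fun j => (1 : Matrix m m ℂ) ⊗ₖ B j))
        - fromBlocks
            (∑ k, (p k : ℂ) • symCovMat (vecMulVec (a k) (star (a k))) A) 0 0
            (∑ k, (p k : ℂ) • symCovMat (vecMulVec (b k) (star (b k))) B)).PosSemidef
      ↔ ∀ v : ι ⊕ κ → ℝ, ∑ k, p k * quadSum (blockCov A B (a k, b k)) v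
          ≤ quadSum (fun i j => (symCovMat ρ (Sum.elim (fun i => A i ⊗ₖ (1 : Matrix n n ℂ))
              (fun j => (1 : Matrix m m ℂ) ⊗ₖ B j)) i j).re) v := by
  rw [posSemidef_iff_quadSum]
  · have key : (fun i j => (symCovMat ρ (Sum.elim (fun i => A i ⊗ₖ (1 : Matrix n n ℂ))
          (fun j => (1 : Matrix m m ℂ) ⊗ₖ B j)) i j).re)
        = (fun i j => ((symCovMat ρ (Sum.elim (fun i => A i ⊗ₖ (1 : Matrix n n ℂ))
          (fun j => (1 : Matrix m m ℂ) ⊗ₖ B j))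
        - fromBlocks
            (∑ k, (p k : ℂ) • symCovMat (vecMulVec (a k) (star (a k))) A) 0 0
            (∑ k, (p k : ℂ) • symCovMat (vecMulVec (b k) (star (b k))) B)) i j).re)
          + ∑ k, p k • blockCov A B (a k, b k) := by
      ext i j
      rcases i with i | i <;> rcases j with j | j <;>
        simp [blockCov, Matrix.sum_apply, Finset.sum_apply]
    refine forall_congr' fun v => ?_
    rw [key, quadSum_add, quadSum_sum, le_add_iff_nonneg_left]
  · intro i j
    have h := symCovMat_im hρ (isHermitian_sumElim_kronecker hA hB) i j
    rw [Matrix.sub_apply, Complex.sub_im, h, zero_sub, neg_eq_zero]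
    rcases i with i | i <;> rcases j with j | j <;>
      simp [Matrix.sum_apply, symCovMat_im (isHermitian_vecMulVec_star _) hA,
        symCovMat_im (isHermitian_vecMulVec_star _) hB]
  · intro i j
    rw [Matrix.sub_apply, Matrix.sub_apply, symCovMat_comm]
    congr 1
    rcases i with i | i <;> rcases j with j | j <;> simp [Matrix.sum_apply] <;>
      exact Finset.sum_congr rfl fun k _ => by rw [symCovMat_comm]

theorem bddBelow_sum_realVar {n κ : Type*} [Fintype n] [Fintype κ] {X : κ → Matrix n n ℂ}
    (hX : ∀ k, (X k).IsHermitian) :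
    BddBelow {x : ℝ | ∃ a : n → ℂ, star a ⬝ᵥ a = 1 ∧
      x = ∑ k, realVar (vecMulVec a (star a)) (X k)} := by
  refine ⟨0, ?_⟩
  rintro _ ⟨a, ha, rfl⟩
  refine Finset.sum_nonneg fun k _ => realVar_nonneg (posSemidef_vecMulVec_self_star a) ?_ (hX k)
  rw [Matrix.trace_vecMulVec, dotProduct_comm, ha]

/-- Equivalence between the symmetric covariance matrix criterion and the
criterion based on local uncertainty relations (LURs): a state satisfies the
symmetric CMC iff it satisfies every local uncertainty relation. -/
theorem symCMC_iff_LUR {dA dB : ℕ}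
    (ρ : Matrix (Fin dA × Fin dB) (Fin dA × Fin dB) ℂ)
    (hρ : ρ.PosSemidef) (hρ1 : ρ.trace = 1)
    (A : Fin (dA ^ 2) → Matrix (Fin dA) (Fin dA) ℂ)
    (hAH : ∀ i, (A i).IsHermitian)
    (hAON : ∀ i j, (A i * A j).trace = if i = j then 1 else 0)
    (B : Fin (dB ^ 2) → Matrix (Fin dB) (Fin dB) ℂ)
    (hBH : ∀ j, (B j).IsHermitian)
    (hBON : ∀ i j, (B i * B j).trace = if i = j then 1 else 0) :
    (∃ (m : ℕ) (p : Fin m → ℝ) (a : Fin m → Fin dA → ℂ) (b : Fin m → Fin dB → ℂ),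
      (∀ k, 0 ≤ p k) ∧ (∑ k, p k = 1) ∧
      (∀ k, star (a k) ⬝ᵥ a k = 1) ∧ (∀ k, star (b k) ⬝ᵥ b k = 1) ∧
      (symCovMat ρ (Sum.elim (fun i => A i ⊗ₖ (1 : Matrix (Fin dB) (Fin dB) ℂ))
            (fun j => (1 : Matrix (Fin dA) (Fin dA) ℂ) ⊗ₖ B j))
        - Matrix.fromBlocks
            (∑ k, (p k : ℂ) • symCovMat (vecMulVec (a k) (star (a k))) A) 0 0
            (∑ k, (p k : ℂ) • symCovMat (vecMulVec (b k) (star (b k))) B)).PosSemidef)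
    ↔
    (∀ (K : ℕ) (Ah : Fin K → Matrix (Fin dA) (Fin dA) ℂ)
        (Bh : Fin K → Matrix (Fin dB) (Fin dB) ℂ),
      (∀ k, (Ah k).IsHermitian) → (∀ k, (Bh k).IsHermitian) →
      sInf {x : ℝ | ∃ a : Fin dA → ℂ, star a ⬝ᵥ a = 1 ∧
            x = ∑ k, realVar (vecMulVec a (star a)) (Ah k)}
        + sInf {x : ℝ | ∃ b : Fin dB → ℂ, star b ⬝ᵥ b = 1 ∧
            x = ∑ k, realVar (vecMulVec b (star b)) (Bh k)}
      ≤ ∑ k, realVar ρ (Ah k ⊗ₖ (1 : Matrix (Fin dB) (Fin dB) ℂ)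
            + (1 : Matrix (Fin dA) (Fin dA) ℂ) ⊗ₖ Bh k)) := by
  classical
  have hρH := hρ.isHermitian
  have hquad : ∀ v : Fin (dA ^ 2) ⊕ Fin (dB ^ 2) → ℝ,
      quadSum (fun i j => (symCovMat ρ (Sum.elim
          (fun i => A i ⊗ₖ (1 : Matrix (Fin dB) (Fin dB) ℂ))
          (fun j => (1 : Matrix (Fin dA) (Fin dA) ℂ) ⊗ₖ B j)) i j).re) v
        = realVar ρ ((∑ i, (v (.inl i) : ℂ) • A i) ⊗ₖ (1 : Matrix (Fin dB) (Fin dB) ℂ)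
            + (1 : Matrix (Fin dA) (Fin dA) ℂ) ⊗ₖ ∑ j, (v (.inr j) : ℂ) • B j) := fun v => by
    rw [quadSum_symCovMat hρH (isHermitian_sumElim_kronecker hAH hBH), sum_smul_sumElim_kronecker]
  constructor
  · rintro ⟨m, p, a, b, hp, hp1, ha, hb, hPSD⟩ K Ah Bh hAh hBh
    rw [posSemidef_sub_fromBlocks_iff hρH hAH hBH] at hPSD
    choose α hα using fun k => exists_real_coeff (by simp) hAH hAON (hAh k)
    choose β hβ using fun k => exists_real_coeff (by simp) hBH hBON (hBh k)
    have hbound : ∀ k, ∑ l, p l * (realVar (vecMulVec (a l) (star (a l))) (Ah k)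
          + realVar (vecMulVec (b l) (star (b l))) (Bh k))
        ≤ realVar ρ (Ah k ⊗ₖ (1 : Matrix (Fin dB) (Fin dB) ℂ)
            + (1 : Matrix (Fin dA) (Fin dA) ℂ) ⊗ₖ Bh k) := by
      intro k
      have h := hPSD (Sum.elim (α k) (β k))
      rw [hquad] at h
      simp only [quadSum_blockCov hAH hBH, Sum.elim_inl, Sum.elim_inr, ← hα, ← hβ] at h
      exact h
    refine le_trans ?_ (Finset.sum_le_sum fun k _ => hbound k)
    rw [Finset.sum_comm]
    have hinf : ∀ l, sInf {x : ℝ | ∃ a : Fin dA → ℂ, star a ⬝ᵥ a = 1 ∧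
            x = ∑ k, realVar (vecMulVec a (star a)) (Ah k)}
        + sInf {x : ℝ | ∃ b : Fin dB → ℂ, star b ⬝ᵥ b = 1 ∧
            x = ∑ k, realVar (vecMulVec b (star b)) (Bh k)}
        ≤ ∑ k, (realVar (vecMulVec (a l) (star (a l))) (Ah k)
          + realVar (vecMulVec (b l) (star (b l))) (Bh k)) := by
      intro l
      rw [Finset.sum_add_distrib]
      exact add_le_add (csInf_le (bddBelow_sum_realVar hAh) ⟨a l, ha l, rfl⟩)
        (csInf_le (bddBelow_sum_realVar hBh) ⟨b l, hb l, rfl⟩)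
    calc _ = ∑ l, p l * (sInf {x : ℝ | ∃ a : Fin dA → ℂ, star a ⬝ᵥ a = 1 ∧
              x = ∑ k, realVar (vecMulVec a (star a)) (Ah k)}
            + sInf {x : ℝ | ∃ b : Fin dB → ℂ, star b ⬝ᵥ b = 1 ∧
              x = ∑ k, realVar (vecMulVec b (star b)) (Bh k)}) := by
          rw [← Finset.sum_mul, hp1, one_mul]
      _ ≤ _ := Finset.sum_le_sum fun l _ => by
          rw [← Finset.mul_sum]
          exact mul_le_mul_of_nonneg_left (hinf l) (hp l)
  · intro hLUR
    by_contra hcon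
    have hne : Nonempty (Fin dA × Fin dB) := by
      by_contra h
      rw [not_nonempty_iff] at h
      simp [Matrix.trace] at hρ1
    have : Nonempty (Fin dA) := hne.map Prod.fst
    have : Nonempty (Fin dB) := hne.map Prod.snd
    set U : Set ((Fin dA → ℂ) × (Fin dB → ℂ)) :=
      {a | star a ⬝ᵥ a = 1} ×ˢ {b | star b ⬝ᵥ b = 1} with hU
    have hS : IsCompact (convexHull ℝ (blockCov A B '' U)) :=
      (((isCompact_unit_vectors _).prod (isCompact_unit_vectors _)).image
        (continuous_blockCov A B)).convexHull_of_finiteDimensional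
    obtain ⟨w, c, hlt, hc⟩ := exists_separating_quadSum hS (convex_convexHull ℝ _)
      (fun i j => (symCovMat ρ (Sum.elim (fun i => A i ⊗ₖ (1 : Matrix (Fin dB) (Fin dB) ℂ))
          (fun j => (1 : Matrix (Fin dA) (Fin dA) ℂ) ⊗ₖ B j)) i j).re) (by
        intro X hX
        by_contra! hle
        obtain ⟨τ, _, p, z, hp, hp1, hz, rfl⟩ := mem_convexHull_iff_exists_fintype.1 hX
        choose q hqU hq using hz
        let e := (Fintype.equivFin τ).symm
        refine hcon ⟨Fintype.card τ, fun k => p (e k), fun k => (q (e k)).1, fun k => (q (e k)).2,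
          fun k => hp _, (e.sum_comp p).trans hp1, fun k => (hqU _).1, fun k => (hqU _).2, ?_⟩
        rw [posSemidef_sub_fromBlocks_iff hρH hAH hBH]
        intro v
        refine le_of_eq_of_le ?_ (hle v)
        rw [quadSum_sum, ← e.sum_comp]
        simp only [Prod.mk.eta, hq])
    let e := (Fintype.equivFin (Fin (dA ^ 2) ⊕ Fin (dB ^ 2))).symm
    have h := hLUR _ (fun k => ∑ i, (w (e k) (.inl i) : ℂ) • A i)
      (fun k => ∑ j, (w (e k) (.inr j) : ℂ) • B j)
      (fun k => isHermitian_sum_ofReal_smul hAH _) (fun k => isHermitian_sum_ofReal_smul hBH _)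
    simp only [← hquad] at h
    rw [e.sum_comp fun k => quadSum _ (w k)] at h
    refine (h.trans_lt hlt).not_ge ?_
    obtain ⟨a₀, ha₀⟩ := exists_unit_vector (Fin dA)
    obtain ⟨b₀, hb₀⟩ := exists_unit_vector (Fin dB)
    rw [← sub_le_iff_le_add']
    refine le_csInf ⟨_, b₀, hb₀, rfl⟩ ?_
    rintro _ ⟨b, hb, rfl⟩
    rw [sub_le_comm]
    refine le_csInf ⟨_, a₀, ha₀, rfl⟩ ?_
    rintro _ ⟨a, ha, rfl⟩
    rw [sub_le_iff_le_add, ← Finset.sum_add_distrib]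
    refine (hc _ (subset_convexHull ℝ _ ⟨(a, b), ⟨ha, hb⟩, rfl⟩)).le.trans_eq ?_
    rw [← e.sum_comp]
    simp only [quadSum_blockCov hAH hBH]
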